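/- Let α₁, α₂ : ℝ → ℝ be differentiable functions such that for every x ≥ 0: α₁'(x) = α₁(x)² − α₂(x)² − x, α₂'(x) = 2 α₁(x) α₂(x), and α₂(x) > 0. If α₁(0) < 0, then α₁(x) < 0 for every x ≥ 0. -/

import Mathlib

/-- Key step in the proof of Lemma B.3 (iii) of the paper: if `α₁, α₂` solve
`α₁' = α₁² − α₂² − x`, `α₂' = 2α₁α₂` on `[0,∞)` with `α₂ > 0` there and
`α₁(0) < 0`, then `α₁ < 0` on `[0,∞)`. -/
theorem stmt_13 (α₁ α₂ : ℝ → ℝ)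
    (h₁ : Differentiable ℝ α₁) (h₂ : Differentiable ℝ α₂)
    (hode₁ : ∀ x : ℝ, 0 ≤ x → deriv α₁ x = α₁ x ^ 2 - α₂ x ^ 2 - x)
    (hode₂ : ∀ x : ℝ, 0 ≤ x → deriv α₂ x = 2 * α₁ x * α₂ x)
    (hpos : ∀ x : ℝ, 0 ≤ x → 0 < α₂ x)
    (h0 : α₁ 0 < 0) :
    ∀ x : ℝ, 0 ≤ x → α₁ x < 0 := by
  have hquot : ∀ x : ℝ, 0 ≤ x →
      HasDerivAt (fun t => α₁ t / α₂ t) (-(α₁ x ^ 2 + α₂ x ^ 2 + x) / α₂ x) x := by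
    intro x hx
    have hne := (hpos x hx).ne'
    have hd := (h₁ x).hasDerivAt.div (h₂ x).hasDerivAt hne
    rw [hode₁ x hx, hode₂ x hx] at hd
    refine hd.congr_deriv ?_
    field_simp
    ring
  have hanti : AntitoneOn (fun t => α₁ t / α₂ t) (Set.Ici 0) := by
    refine antitoneOn_of_deriv_nonpos (convex_Ici 0)
      (fun x hx => (hquot x hx).continuousAt.continuousWithinAt)
      (fun x hx => (hquot x (interior_subset hx)).differentiableAt.differentiableWithinAt)
      fun x hx => ?_
    have hx : 0 ≤ x := interior_subset hx
    rw [(hquot x hx).deriv]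
    exact div_nonpos_of_nonpos_of_nonneg (neg_nonpos.mpr (by positivity)) (hpos x hx).le
  intro x hx
  have hlt : α₁ x / α₂ x < 0 :=
    (hanti Set.self_mem_Ici hx hx).trans_lt (div_neg_of_neg_of_pos h0 (hpos 0 le_rfl))
  exact neg_of_div_neg_left hlt (hpos x hx).le
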